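/- In the PSD-id iteration with an effectively positive definite preconditioner K at step j, the eigenvalue decrease satisfies λ_{i;j} − λ_{i;j+1} ≥ sqrt(g² + φ²) − g, where g = (λₙ − λᵢ)/2 and φ = ‖r_{i;j}‖_{S^{−1}} / κ(K^c), with κ(K^c) the condition number of K^c = (U_{i−1}^c)^H S K S U_{i−1}^c, provided r_{i;j} ≠ 0. -/

import Mathlib

open Matrix
open scoped ComplexOrder

lemma aux_real (D g R γ Γ β W Q : ℝ) (hg : 0 ≤ g) (hγ : 0 < γ) (hγΓ : γ ≤ Γ) (hR : 0 < R)
    (h : ∀ τ : ℝ, 0 ≤ D - 2 * τ * β + τ ^ 2 * Q) (hQ : Q ≤ (2 * g + D) * W)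
    (hW : W ≤ Γ ^ 2 * R ^ 2) (hβ : γ * R ^ 2 ≤ β) :
    Real.sqrt (g ^ 2 + (R / (Γ / γ)) ^ 2) - g ≤ D := by
  have hΓ : 0 < Γ := lt_of_lt_of_le hγ hγΓ
  have hD : 0 ≤ D := by have := h 0; simpa using this
  have hβ0 : 0 < β := lt_of_lt_of_le (by positivity) hβ
  set φ := R / (Γ / γ) with hφ
  have hφ0 : 0 < φ := by positivity
  set T := 2 * g + D with hT
  have hT0 : 0 ≤ T := by positivity
  have hQ2 : Q ≤ T * (Γ ^ 2 * R ^ 2) := hQ.trans (mul_le_mul_of_nonneg_left hW hT0)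
  have key : ∀ s : ℝ, 0 ≤ s → 0 ≤ D - 2 * s * φ + s ^ 2 * T := by
    intro s hs
    have h1 := h (s / (Γ * R))
    have h2 : (s / (Γ * R)) ^ 2 * Q ≤ s ^ 2 * T := by
      calc (s / (Γ * R)) ^ 2 * Q ≤ (s / (Γ * R)) ^ 2 * (T * (Γ ^ 2 * R ^ 2)) :=
            mul_le_mul_of_nonneg_left hQ2 (by positivity)
        _ = s ^ 2 * T := by field_simp
    have h3 : s * φ ≤ (s / (Γ * R)) * β := by
      calc s * φ = (s / (Γ * R)) * (γ * R ^ 2) := by rw [hφ]; field_simp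
        _ ≤ _ := mul_le_mul_of_nonneg_left hβ (by positivity)
    nlinarith
  have hTpos : 0 < T := by
    rcases hT0.eq_or_lt with h0 | h0
    · have := key ((D + 1) / φ) (by positivity)
      rw [← h0] at this
      have e : 2 * ((D + 1) / φ) * φ = 2 * (D + 1) := by field_simp
      rw [e] at this
      linarith
    · exact h0
  have hdisc : φ ^ 2 ≤ D * T := by
    have := key (φ / T) (by positivity)
    have e : D - 2 * (φ / T) * φ + (φ / T) ^ 2 * T = (D * T - φ ^ 2) / T := by
      field_simp; ring
    rw [e] at this
    have := (div_nonneg_iff.1 this)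
    rcases this with h | h <;> linarith
  have : Real.sqrt (g ^ 2 + φ ^ 2) ≤ D + g := by
    apply Real.sqrt_le_iff.2
    refine ⟨by positivity, ?_⟩
    nlinarith
  linarith

lemma aux_self {N : ℕ} (x : Fin N → ℂ) : star x ⬝ᵥ x = ((∑ k, Complex.normSq (x k) : ℝ) : ℂ) := by
  simp [dotProduct, Complex.normSq_eq_conj_mul_self]

lemma aux_diag {N : ℕ} (lam : Fin N → ℝ) (x : Fin N → ℂ) :
    star x ⬝ᵥ ((Matrix.diagonal fun k => (lam k : ℂ)) *ᵥ x)
      = ((∑ k, lam k * Complex.normSq (x k) : ℝ) : ℂ) := by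
  simp [dotProduct, mulVec_diagonal, Complex.normSq_eq_conj_mul_self]
  exact Finset.sum_congr rfl fun k _ => by ring

lemma aux_swap {N : ℕ} (A : Matrix (Fin N) (Fin N) ℂ) (hA : A.IsHermitian) (x y : Fin N → ℂ) :
    star (A *ᵥ x) ⬝ᵥ y = star x ⬝ᵥ (A *ᵥ y) := by
  rw [star_mulVec, hA.eq, dotProduct_mulVec]

lemma aux_conj {N : ℕ} (x y : Fin N → ℂ) : star y ⬝ᵥ x = star (star x ⬝ᵥ y) := by
  rw [star_dotProduct]

lemma aux_K {N : ℕ} (K : Matrix (Fin N) (Fin N) ℂ) (hK : K.PosDef) (Γ : ℝ) (hΓ : 0 < Γ)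
    (hb : ∀ x : Fin N → ℂ, (star x ⬝ᵥ (K *ᵥ x)).re ≤ Γ * (star x ⬝ᵥ x).re) (x : Fin N → ℂ) :
    (star (K *ᵥ x) ⬝ᵥ (K *ᵥ x)).re ≤ Γ ^ 2 * (star x ⬝ᵥ x).re := by
  set z := K *ᵥ x with hz
  have h1 := hK.posSemidef.re_dotProduct_nonneg ((Γ : ℂ) • x - z)
  have h2 := hb x
  have h3 := hb z
  have e1 : star x ⬝ᵥ (K *ᵥ z) = star z ⬝ᵥ z := by rw [← aux_swap K hK.1, ← hz]
  have e2 : (star ((Γ : ℂ) • x - z) ⬝ᵥ (K *ᵥ ((Γ : ℂ) • x - z))).re =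
      Γ ^ 2 * (star x ⬝ᵥ (K *ᵥ x)).re - 2 * Γ * (star z ⬝ᵥ z).re + (star z ⬝ᵥ (K *ᵥ z)).re := by
    simp only [mulVec_sub, mulVec_smul, star_sub, star_smul, sub_dotProduct, dotProduct_sub,
      smul_dotProduct, dotProduct_smul, e1, ← hz]
    simp [aux_self]
    ring
  simp only [RCLike.re_to_complex] at h1
  rw [e2] at h1
  have h4 : Γ * (star z ⬝ᵥ z).re ≤ Γ * (Γ ^ 2 * (star x ⬝ᵥ x).re) := by
    nlinarith [mul_le_mul_of_nonneg_left h2 (sq_nonneg Γ)]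
  exact le_of_mul_le_mul_left h4 hΓ

lemma aux_core {N : ℕ} (lam : Fin N → ℝ) (l L : ℝ) (hl : ∀ k, l ≤ lam k) (hL : ∀ k, lam k ≤ L)
    (hlL : l ≤ L)
    (a : Fin N → ℂ) (ha : star a ⬝ᵥ a = 1) (Λ : Matrix (Fin N) (Fin N) ℂ)
    (hΛ : Λ = Matrix.diagonal fun k => (lam k : ℂ)) (lamj : ℝ)
    (hj : (lamj : ℂ) = star a ⬝ᵥ (Λ *ᵥ a))
    (ρ : Fin N → ℂ) (hρ : ρ = Λ *ᵥ a - (lamj : ℂ) • a) (hρ0 : ρ ≠ 0)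
    (K : Matrix (Fin N) (Fin N) ℂ) (hK : K.PosDef) (γ Γ : ℝ) (hγ : 0 < γ) (hγΓ : γ ≤ Γ)
    (hbound : ∀ x : Fin N → ℂ,
      γ * (star x ⬝ᵥ x).re ≤ (star x ⬝ᵥ (K *ᵥ x)).re ∧
      (star x ⬝ᵥ (K *ᵥ x)).re ≤ Γ * (star x ⬝ᵥ x).re)
    (lamj1 : ℝ)
    (hmin : ∀ α β : ℂ, α • a + β • (-(K *ᵥ ρ)) ≠ 0 →
      lamj1 ≤ ((star (α • a + β • (-(K *ᵥ ρ))) ⬝ᵥ (Λ *ᵥ (α • a + β • (-(K *ᵥ ρ))))) /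
        (star (α • a + β • (-(K *ᵥ ρ))) ⬝ᵥ (α • a + β • (-(K *ᵥ ρ))))).re) :
    Real.sqrt (((L - l) / 2) ^ 2 +
        (Real.sqrt ((star ρ ⬝ᵥ ρ).re) / (Γ / γ)) ^ 2) - (L - l) / 2 ≤ lamj - lamj1 := by
  have hΓ : 0 < Γ := lt_of_lt_of_le hγ hγΓ
  have hΛh : Λ.IsHermitian := by
    rw [hΛ]; apply isHermitian_diagonal_of_self_adjoint
    ext k; simp
  set q := -(K *ᵥ ρ) with hq
  set c := star a ⬝ᵥ q with hc
  set w := q - c • a with hw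
  have haw : star a ⬝ᵥ w = 0 := by simp [hw, dotProduct_sub, ha, hc]
  have hwa : star w ⬝ᵥ a = 0 := by rw [aux_conj, haw, star_zero]
  have hρa : star ρ ⬝ᵥ a = 0 := by
    rw [aux_conj]
    simp [hρ, dotProduct_sub, ← hj, ha]
  have hRpos : 0 < (star ρ ⬝ᵥ ρ).re := by
    have := dotProduct_star_self_pos_iff.2 hρ0
    exact (Complex.pos_iff.1 this).1
  set β : ℝ := (star ρ ⬝ᵥ (K *ᵥ ρ)).re with hβ
  have haΛw : star a ⬝ᵥ (Λ *ᵥ w) = star ρ ⬝ᵥ w := by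
    rw [← aux_swap Λ hΛh]
    have : Λ *ᵥ a = ρ + (lamj : ℂ) • a := by rw [hρ]; abel
    rw [this]
    simp [add_dotProduct, haw]
  have hρw : star ρ ⬝ᵥ w = -(star ρ ⬝ᵥ (K *ᵥ ρ)) := by
    simp [hw, dotProduct_sub, hρa, hq]
  have hre1 : (star a ⬝ᵥ (Λ *ᵥ w)).re = -β := by rw [haΛw, hρw]; simp [hβ]
  have hre2 : (star w ⬝ᵥ (Λ *ᵥ a)).re = -β := by
    rw [← aux_swap Λ hΛh, aux_conj, ← hre1]; simp
  have hRay : ∀ x : Fin N → ℂ, (star x ⬝ᵥ (Λ *ᵥ x)).re ≤ L * (star x ⬝ᵥ x).re := by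
    intro x
    rw [hΛ, aux_diag, aux_self, Complex.ofReal_re, Complex.ofReal_re, Finset.mul_sum]
    exact Finset.sum_le_sum fun k _ => mul_le_mul_of_nonneg_right (hL k) (Complex.normSq_nonneg _)
  have hlj : l ≤ lamj := by
    have h1 : (∑ k, l * Complex.normSq (a k)) ≤ ∑ k, lam k * Complex.normSq (a k) :=
      Finset.sum_le_sum fun k _ => mul_le_mul_of_nonneg_right (hl k) (Complex.normSq_nonneg _)
    rw [← Finset.mul_sum] at h1
    rw [aux_self] at ha
    rw [hΛ, aux_diag] at hj
    have ha' : (∑ k, Complex.normSq (a k)) = 1 := by exact_mod_cast ha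
    have hj' : lamj = ∑ k, lam k * Complex.normSq (a k) := by exact_mod_cast hj
    rw [ha', ← hj', mul_one] at h1
    exact h1
  have hww : 0 ≤ (star w ⬝ᵥ w).re := by
    rw [aux_self, Complex.ofReal_re]
    exact Finset.sum_nonneg fun k _ => Complex.normSq_nonneg _
  apply aux_real (lamj - lamj1) ((L - l) / 2) _ γ Γ β (star w ⬝ᵥ w).re
    ((star w ⬝ᵥ (Λ *ᵥ w)).re - lamj1 * (star w ⬝ᵥ w).re) (by linarith) hγ hγΓ
    (Real.sqrt_pos.2 hRpos)
  · intro τ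
    have hy : (1 - τ * c) • a + (τ : ℂ) • q = a + (τ : ℂ) • w := by
      rw [hw, smul_sub, sub_smul, smul_smul, one_smul]; abel
    have h := hmin (1 - τ * c) τ
    rw [hy] at h
    set y := a + (τ : ℂ) • w with hyd
    have hy0 : y ≠ 0 := by
      intro h0
      have : star a ⬝ᵥ y = 1 := by simp [hyd, dotProduct_add, ha, haw]
      rw [h0] at this
      simp at this
    have h := h hy0
    have hpos : 0 < (star y ⬝ᵥ y).re := by
      have := dotProduct_star_self_pos_iff.2 hy0
      exact (Complex.pos_iff.1 this).1
    have hyy : star y ⬝ᵥ y = (((star y ⬝ᵥ y).re : ℝ) : ℂ) := by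
      rw [aux_self, Complex.ofReal_re]
    rw [hyy, Complex.div_ofReal_re, le_div_iff₀ hpos] at h
    have e1 : (star y ⬝ᵥ y).re = 1 + τ ^ 2 * (star w ⬝ᵥ w).re := by
      simp only [hyd, star_add, star_smul, add_dotProduct, dotProduct_add, smul_dotProduct,
        dotProduct_smul, ha, haw, hwa]
      simp
      ring
    have e2 : (star y ⬝ᵥ (Λ *ᵥ y)).re
        = lamj - 2 * τ * β + τ ^ 2 * (star w ⬝ᵥ (Λ *ᵥ w)).re := by
      simp only [hyd, star_add, star_smul, add_dotProduct, dotProduct_add, smul_dotProduct,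
        dotProduct_smul, mulVec_add, mulVec_smul, ← hj]
      simp [hre1, hre2]
      ring
    rw [e1, e2] at h
    linarith
  · have := hRay w
    nlinarith
  · rw [Real.sq_sqrt hRpos.le]
    refine le_trans ?_ (aux_K K hK Γ hΓ (fun x => (hbound x).2) ρ)
    have e : star (K *ᵥ ρ) ⬝ᵥ (K *ᵥ ρ) = star q ⬝ᵥ q := by simp [hq]
    have hqd : q = w + c • a := by rw [hw]; abel
    rw [e, hqd]
    simp only [star_add, star_smul, add_dotProduct, dotProduct_add, smul_dotProduct,
        dotProduct_smul, ha, haw, hwa]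
    simp
    nlinarith [mul_self_nonneg c.re, mul_self_nonneg c.im]
  · rw [Real.sq_sqrt hRpos.le]
    exact (hbound ρ).1

lemma aux_tail {n m : ℕ} (hmn : m < n) (f : Fin n → ℂ) (hf : ∀ k : Fin n, (k : ℕ) < m → f k = 0)
    (e : Fin (n - m) → Fin n) (he : ∀ k, (e k : ℕ) = m + k) :
    ∑ k, f k = ∑ k : Fin (n - m), f (e k) := by
  obtain ⟨N, rfl⟩ : ∃ N, n = m + N := ⟨n - m, by omega⟩
  rw [Fin.sum_univ_add, Finset.sum_eq_zero (fun i _ => hf _ (by simp)), zero_add]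
  have hN : m + N - m = N := by omega
  refine Fintype.sum_equiv (finCongr hN.symm) _ _ fun k => ?_
  congr 1
  ext
  simp [he]

lemma aux_head {n m : ℕ} (hmn : m < n) (f : Fin n → ℂ) (hf : ∀ k : Fin n, m ≤ (k : ℕ) → f k = 0)
    (e : Fin m → Fin n) (he : ∀ k, (e k : ℕ) = k) :
    ∑ k, f k = ∑ k : Fin m, f (e k) := by
  obtain ⟨N, rfl⟩ : ∃ N, n = m + N := ⟨n - m, by omega⟩
  rw [Fin.sum_univ_add, Finset.sum_eq_zero (s := (Finset.univ : Finset (Fin N)))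
    (fun i _ => hf _ (by simp)), add_zero]
  refine Finset.sum_congr rfl fun k _ => ?_
  congr 1
  ext
  simp [he]

/-- Lemma 1 of the paper: one-step decrease of the PSD-id iteration. With an effectively
positive definite preconditioner `K` whose reduced matrix `Kᶜ` has eigenvalue bounds
`0 < γ ≤ … ≤ Γ` (condition number `κ = Γ/γ`), and `λ_{i;j+1}` the `i`-th Ritz value
(characterized as the minimum of the Rayleigh quotient over the search subspace, subject to
`S`-orthogonality against `U_{i−1}`), one has
`λ_{i;j} − λ_{i;j+1} ≥ √(g² + φ²) − g` with `g = (λₙ − λᵢ)/2`, `φ = ‖r‖_{S⁻¹}/κ`. -/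
theorem stmt9 {n m : ℕ} (hmn : m < n)
    (H S U Λ K : Matrix (Fin n) (Fin n) ℂ) (lam : Fin n → ℝ)
    (hH : H.IsHermitian) (hS : S.PosDef)
    (hΛ : Λ = Matrix.diagonal fun k => (lam k : ℂ))
    (hmono : Monotone lam)
    (hortho : Uᴴ * S * U = 1)
    (heig : H * U = S * U * Λ)
    (u : Fin n → ℂ)
    (huorth : ∀ k : Fin n, (k : ℕ) < m → (Uᴴ *ᵥ (S *ᵥ u)) k = 0)
    (hunorm : star u ⬝ᵥ (S *ᵥ u) = 1)
    (lamj : ℝ) (hlamj : (lamj : ℂ) = star u ⬝ᵥ (H *ᵥ u))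
    (r : Fin n → ℂ) (hr : r = H *ᵥ u - (lamj : ℂ) • (S *ᵥ u)) (hrne : r ≠ 0)
    (p : Fin n → ℂ) (hp : p = -(K *ᵥ r))
    (Kc : Matrix (Fin (n - m)) (Fin (n - m)) ℂ)
    (hKc : Kc = (Uᴴ * S * K * S * U).submatrix
      (fun k => (⟨m + k.1, by have := k.2; omega⟩ : Fin n))
      (fun k => (⟨m + k.1, by have := k.2; omega⟩ : Fin n)))
    (hKcpd : Kc.PosDef)
    (γ Γ : ℝ) (hγ : 0 < γ) (hγΓ : γ ≤ Γ)
    (hbound : ∀ x : Fin (n - m) → ℂ,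
      γ * (star x ⬝ᵥ x).re ≤ (star x ⬝ᵥ (Kc *ᵥ x)).re ∧
      (star x ⬝ᵥ (Kc *ᵥ x)).re ≤ Γ * (star x ⬝ᵥ x).re)
    (Z : Matrix (Fin n) (Fin (m + 2)) ℂ)
    (hZ : Z = fun (k : Fin n) (j : Fin (m + 2)) =>
      if h : (j : ℕ) < m then U k ⟨(j : ℕ), by omega⟩
      else if (j : ℕ) = m then u k else p k)
    (lamj1 : ℝ)
    (hlamj1 : IsLeast {x : ℝ | ∃ w : Fin (m + 2) → ℂ, Z *ᵥ w ≠ 0 ∧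
      (∀ k : Fin n, (k : ℕ) < m → (Uᴴ *ᵥ (S *ᵥ (Z *ᵥ w))) k = 0) ∧
      x = ((star (Z *ᵥ w) ⬝ᵥ (H *ᵥ (Z *ᵥ w))) /
            (star (Z *ᵥ w) ⬝ᵥ (S *ᵥ (Z *ᵥ w)))).re} lamj1) :
    Real.sqrt (((lam ⟨n - 1, by omega⟩ - lam ⟨m, hmn⟩) / 2) ^ 2 +
        (Real.sqrt ((star r ⬝ᵥ (S⁻¹ *ᵥ r)).re) / (Γ / γ)) ^ 2) -
      (lam ⟨n - 1, by omega⟩ - lam ⟨m, hmn⟩) / 2 ≤ lamj - lamj1 := by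
  obtain ⟨e, he⟩ : ∃ e : Fin (n - m) → Fin n,
      e = fun k => (⟨m + k.1, by have := k.2; omega⟩ : Fin n) := ⟨_, rfl⟩
  have hem : ∀ k, m ≤ (e k : ℕ) := by intro k; simp [he]
  rw [← he] at hKc
  have htail : ∀ f : Fin n → ℂ, (∀ k : Fin n, (k : ℕ) < m → f k = 0) →
      ∑ k, f k = ∑ k, f (e k) := by
    intro f hf; exact aux_tail hmn f hf e (by intro k; simp [he])
  have hinv : U * (Uᴴ * S) = 1 := mul_eq_one_comm.1 hortho
  have hinv2 : (S * U) * Uᴴ = 1 := by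
    have : Uᴴ * (S * U) = 1 := by rw [← Matrix.mul_assoc]; exact hortho
    exact mul_eq_one_comm.1 this
  -- coordinates
  obtain ⟨a, ha⟩ : ∃ a, a = Uᴴ *ᵥ (S *ᵥ u) := ⟨_, rfl⟩
  have hUa : U *ᵥ a = u := by
    rw [ha, mulVec_mulVec, mulVec_mulVec, Matrix.mul_assoc, hinv, one_mulVec]
  rw [← ha] at huorth
  obtain ⟨b, hb⟩ : ∃ b, b = Uᴴ *ᵥ (S *ᵥ p) := ⟨_, rfl⟩
  have hUb : U *ᵥ b = p := by
    rw [hb, mulVec_mulVec, mulVec_mulVec, Matrix.mul_assoc, hinv, one_mulVec]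
  obtain ⟨ρ, hρ⟩ : ∃ ρ, ρ = Uᴴ *ᵥ r := ⟨_, rfl⟩
  have hSUρ : (S * U) *ᵥ ρ = r := by rw [hρ, mulVec_mulVec, hinv2, one_mulVec]
  have hUHU : Uᴴ * H * U = Λ := by
    rw [Matrix.mul_assoc, heig, ← Matrix.mul_assoc, ← Matrix.mul_assoc, hortho, Matrix.one_mul]
  have hSform : ∀ y, star (U *ᵥ y) ⬝ᵥ (S *ᵥ (U *ᵥ y)) = star y ⬝ᵥ y := by
    intro y
    rw [star_mulVec, ← dotProduct_mulVec, mulVec_mulVec, mulVec_mulVec, hortho, one_mulVec]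
  have hHform : ∀ y, star (U *ᵥ y) ⬝ᵥ (H *ᵥ (U *ᵥ y)) = star y ⬝ᵥ (Λ *ᵥ y) := by
    intro y
    rw [star_mulVec, ← dotProduct_mulVec, mulVec_mulVec, mulVec_mulVec, hUHU]
  have hρa : ρ = Λ *ᵥ a - (lamj : ℂ) • a := by
    rw [hρ, hr, mulVec_sub, mulVec_smul, ← ha, ← hUHU]
    congr 1
    rw [← mulVec_mulVec, ← mulVec_mulVec, hUa]
  have hbρ : b = -((Uᴴ * S * K * S * U) *ᵥ ρ) := by
    rw [hb, hp, ← hSUρ]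
    simp only [mulVec_neg, mulVec_mulVec, Matrix.mul_assoc]
  have hρz : ∀ k : Fin n, (k : ℕ) < m → ρ k = 0 := by
    intro k hk
    rw [hρa, hΛ]
    simp [mulVec_diagonal, huorth k hk]
  have hrS : star r ⬝ᵥ (S⁻¹ *ᵥ r) = star ρ ⬝ᵥ ρ := by
    have hdet : IsUnit S.det := (Matrix.isUnit_iff_isUnit_det S).1 hS.isUnit
    have h1 : S⁻¹ *ᵥ r = U *ᵥ ρ := by
      rw [← hSUρ, mulVec_mulVec, ← Matrix.mul_assoc, Matrix.nonsing_inv_mul _ hdet, Matrix.one_mul]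
    rw [h1, ← hSform ρ, ← aux_swap S hS.1, mulVec_mulVec, hSUρ]
  -- restriction to the tail
  have hdot : ∀ x y : Fin n → ℂ, (∀ k : Fin n, (k : ℕ) < m → y k = 0) →
      star x ⬝ᵥ y = star (x ∘ e) ⬝ᵥ (y ∘ e) := by
    intro x y hy
    simp only [dotProduct]
    rw [htail _ (fun k hk => by rw [hy k hk, mul_zero])]
    rfl
  have hΛe : ∀ y : Fin n → ℂ, (Λ *ᵥ y) ∘ e =
      (Matrix.diagonal fun k => ((lam (e k) : ℝ) : ℂ)) *ᵥ (y ∘ e) := by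
    intro y; ext k; simp [hΛ, mulVec_diagonal]
  have hΛz : ∀ y : Fin n → ℂ, (∀ k : Fin n, (k : ℕ) < m → y k = 0) →
      (∀ k : Fin n, (k : ℕ) < m → (Λ *ᵥ y) k = 0) := by
    intro y hy k hk; simp [hΛ, mulVec_diagonal, hy k hk]
  have hbe : b ∘ e = -(Kc *ᵥ (ρ ∘ e)) := by
    ext k
    simp only [hbρ, Function.comp, Pi.neg_apply, mulVec, dotProduct]
    rw [htail _ (fun j hj => by rw [hρz j hj, mul_zero]), hKc]
    rfl
  have hnorm : star a ⬝ᵥ a = 1 := by rw [← hSform a, hUa, hunorm]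
  rw [hrS, hdot ρ ρ hρz]
  apply aux_core (fun k => lam (e k)) (lam ⟨m, hmn⟩) (lam ⟨n - 1, by omega⟩)
    (fun k => hmono (by rw [Fin.le_def]; exact hem k))
    (fun k => hmono (by rw [Fin.le_def]; have := (e k).2; simp only; omega))
    (hmono (by rw [Fin.le_def]; simp only; omega))
    (a ∘ e) (by rw [← hdot a a huorth, hnorm]) _ rfl lamj ?_ (ρ ∘ e) ?_ ?_ Kc hKcpd γ Γ hγ hγΓ
    hbound lamj1
  · intro α τ hne
    rw [← hbe] at hne ⊢
    obtain ⟨y, hy⟩ : ∃ y : Fin n → ℂ, y = fun k : Fin n => if (k : ℕ) < m then 0 else α * a k + τ * b k :=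
      ⟨_, rfl⟩
    have hyz : ∀ k : Fin n, (k : ℕ) < m → y k = 0 := by intro k hk; simp [hy, hk]
    have hye : α • (a ∘ e) + τ • (b ∘ e) = y ∘ e := by
      ext k
      have := hem k
      simp [hy, Nat.not_lt.2 this]
    rw [hye] at hne ⊢
    rw [← hΛe, ← hdot y _ (hΛz y hyz), ← hdot y y hyz, ← hSform y, ← hHform y]
    have hy0 : y ≠ 0 := by rintro h0; apply hne; rw [h0]; rfl
    have hUy : (Uᴴ *ᵥ (S *ᵥ (U *ᵥ y))) = y := by
      rw [mulVec_mulVec, mulVec_mulVec, hortho, one_mulVec]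
    obtain ⟨w, hw⟩ : ∃ w : Fin (m + 2) → ℂ, w = fun j : Fin (m + 2) => if h : (j : ℕ) < m then
      -(τ * b ⟨j, by omega⟩) else if (j : ℕ) = m then α else τ := ⟨_, rfl⟩
    have hZw : Z *ᵥ w = U *ᵥ y := by
      have hyd : y = α • a + τ • b - (fun k : Fin n => if (k : ℕ) < m then τ * b k else 0) := by
        ext k
        by_cases hk : (k : ℕ) < m
        · simp [hy, hk, huorth k hk]
        · simp [hy, hk]
      rw [hyd, mulVec_sub, mulVec_add, mulVec_smul, mulVec_smul, hUa, hUb]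
      ext k
      have h1 : (U *ᵥ (fun k : Fin n => if (k : ℕ) < m then τ * b k else 0)) k =
          ∑ j : Fin m, U k ⟨j.1, by omega⟩ * (τ * b ⟨j.1, by omega⟩) := by
        simp only [mulVec, dotProduct]
        rw [aux_head hmn _ (fun j hj => by simp [Nat.not_lt.2 hj])
          (fun j => ⟨j.1, by omega⟩) (fun _ => rfl)]
        simp
      rw [Pi.sub_apply, h1]
      simp only [mulVec, dotProduct]
      rw [Fin.sum_univ_castSucc, Fin.sum_univ_castSucc, hZ, hw]
      simp
      ring
    apply hlamj1.2
    refine ⟨w, ?_, ?_, ?_⟩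
    · rw [hZw]; intro h0; apply hy0; rw [← hUy, h0]; simp
    · rw [hZw, hUy]; exact hyz
    · rw [hZw]
  · rw [← hΛe, ← hdot a _ (hΛz a huorth), ← hHform a, hUa, hlamj]
  · rw [← hΛe, hρa]; rfl
  · intro h0
    apply hrne
    have : ρ = 0 := by
      ext k
      by_cases hk : (k : ℕ) < m
      · exact hρz k hk
      · have h1 := congrFun h0 ⟨k.1 - m, by omega⟩
        have h2 : e ⟨k.1 - m, by omega⟩ = k := by
          rw [he]; ext; simp only; omega
        simpa [h2] using h1
    rw [← hSUρ, this, mulVec_zero]
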